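/- Let μ, λ, β ≥ 0. Define g : ℝ^{3×3} × ℝ^{3×3} × ℝ → ℝ on the convex set C := {(ξ, η, t) : t > 0} by g(ξ, η, t) := μ·(‖ξ‖² − 3 − 2·ln t) + λ·(t − 1)² + β·‖η‖², where ‖·‖ is the Frobenius norm. Then g is convex on C, and for every real 3×3 matrix ξ with det ξ > 0 one has W(ξ) = g(ξ, Adj ξ, det ξ), where W(ξ) := μ·(tr(ξ·ξᵀ) − 3 − 2·ln(det ξ)) + λ·(det ξ − 1)² + β·tr(Adj ξ · (Adj ξ)ᵀ) and Adj ξ denotes the cofactor matrix of ξ. In other words, the neo-Hookean stored energy W is polyconvex. -/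

import Mathlib

open Matrix

/-- The squared Frobenius norm is convex. -/
theorem convexOn_trace_mul_transpose_self {m n : Type*} [Fintype m] [Fintype n] :
    ConvexOn ℝ Set.univ (fun A : Matrix m n ℝ => Matrix.trace (A * Aᵀ)) := by
  refine ⟨convex_univ, fun A _ B _ a b ha hb hab => ?_⟩
  simp only [Matrix.trace, Matrix.diag_apply, Matrix.mul_apply, Matrix.transpose_apply,
    Matrix.add_apply, Matrix.smul_apply, smul_eq_mul, Finset.mul_sum, ← Finset.sum_add_distrib]
  refine Finset.sum_le_sum fun i _ => Finset.sum_le_sum fun j _ => ?_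
  obtain rfl : b = 1 - a := by linarith
  nlinarith [mul_nonneg (mul_nonneg ha hb) (sq_nonneg (A i j - B i j))]

/-- The volumetric part of the neo-Hookean energy density is convex on the positive half-line. -/
theorem convexOn_neg_log_add_sq {mu lam : ℝ} (hmu : 0 ≤ mu) (hlam : 0 ≤ lam) :
    ConvexOn ℝ (Set.Ioi 0)
      (fun t : ℝ => mu * (-3 - 2 * Real.log t) + lam * (t - 1) ^ 2) := by
  refine ⟨convex_Ioi 0, fun x hx y hy a b ha hb hab => ?_⟩
  have hlog := strictConcaveOn_log_Ioi.concaveOn.2 hx hy ha hb hab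
  simp only [smul_eq_mul] at hlog ⊢
  have h₁ := mul_le_mul_of_nonneg_left hlog hmu
  have h₂ := mul_nonneg hlam (mul_nonneg (mul_nonneg ha hb) (sq_nonneg (x - y)))
  obtain rfl : b = 1 - a := by linarith
  linear_combination 2 * h₁ + h₂

/-- Polyconvexity of the neo-Hookean stored energy: the function
`g(ξ, η, t) = μ(‖ξ‖² − 3 − 2 ln t) + λ(t−1)² + β‖η‖²` is convex on
`C = {(ξ, η, t) : t > 0}`, and `W(ξ) = g(ξ, Adj ξ, det ξ)` whenever
`det ξ > 0`, where `‖·‖²` is the squared Frobenius norm `tr(· ·ᵀ)`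
and `Adj ξ = (adjugate ξ)ᵀ` is the cofactor matrix. -/
theorem neoHookean_polyconvex
    (mu lam beta : ℝ) (hmu : 0 ≤ mu) (hlam : 0 ≤ lam) (hbeta : 0 ≤ beta) :
    ConvexOn ℝ
      {p : Matrix (Fin 3) (Fin 3) ℝ × Matrix (Fin 3) (Fin 3) ℝ × ℝ | 0 < p.2.2}
      (fun p => mu * (Matrix.trace (p.1 * p.1ᵀ) - 3 - 2 * Real.log p.2.2)
        + lam * (p.2.2 - 1) ^ 2 + beta * Matrix.trace (p.2.1 * p.2.1ᵀ))
    ∧ ∀ ξ : Matrix (Fin 3) (Fin 3) ℝ, 0 < ξ.det →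
      mu * (Matrix.trace (ξ * ξᵀ) - 3 - 2 * Real.log ξ.det)
          + lam * (ξ.det - 1) ^ 2
          + beta * Matrix.trace ((ξ.adjugate)ᵀ * ((ξ.adjugate)ᵀ)ᵀ)
        = (fun p : Matrix (Fin 3) (Fin 3) ℝ × Matrix (Fin 3) (Fin 3) ℝ × ℝ =>
            mu * (Matrix.trace (p.1 * p.1ᵀ) - 3 - 2 * Real.log p.2.2)
              + lam * (p.2.2 - 1) ^ 2 + beta * Matrix.trace (p.2.1 * p.2.1ᵀ))
            (ξ, (ξ.adjugate)ᵀ, ξ.det) := by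
  refine ⟨⟨fun p hp q hq a b ha hb hab => ?_, fun p hp q hq a b ha hb hab => ?_⟩,
    fun _ _ => rfl⟩
  · exact convex_Ioi (0 : ℝ) hp hq ha hb hab
  · have h₁ := mul_le_mul_of_nonneg_left
      (convexOn_trace_mul_transpose_self.2 (Set.mem_univ p.1) (Set.mem_univ q.1) ha hb hab) hmu
    have h₂ := mul_le_mul_of_nonneg_left
      (convexOn_trace_mul_transpose_self.2 (Set.mem_univ p.2.1) (Set.mem_univ q.2.1) ha hb hab)
      hbeta
    have h₃ := (convexOn_neg_log_add_sq hmu hlam).2 hp hq ha hb hab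
    simp only [smul_eq_mul, Prod.fst_add, Prod.snd_add, Prod.smul_fst, Prod.smul_snd]
      at h₁ h₂ h₃ ⊢
    linear_combination h₁ + h₂ + h₃
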